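/- arXiv:1202.1236 — 2 statements merged into one kernel-verified Lean document; each statement's English description precedes it below -/
import Mathlib

section
/- Let G : ℝ → ℝ be Lipschitz with Lipschitz constant L₂ and bounded with |G| ≤ B on ℝ, and let w, v : ℝ → ℝ be integrable functions. Then ∫_ℝ | G( ∫_{−∞}^x w(y) dy ) · w(x) − G( ∫_{−∞}^x v(y) dy ) · v(x) | dx ≤ ‖w − v‖_{L¹(ℝ)} · ( L₂ · min( ‖w‖_{L¹(ℝ)}, ‖v‖_{L¹(ℝ)} ) + B ). -/
open MeasureTheory Set

/-- The estimate of `TV_difference_nonlocal_coefficients` with `‖v‖_{L¹}` in place of the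
minimum. -/
theorem integral_abs_nonlocal_sub_le (G w v : ℝ → ℝ) (L₂ B : ℝ)
    (hL₂ : 0 ≤ L₂) (hG : ∀ x y, |G x - G y| ≤ L₂ * |x - y|)
    (hB : ∀ x, |G x| ≤ B)
    (hw : Integrable w) (hv : Integrable v) :
    (∫ x : ℝ, |G (∫ y in Set.Iic x, w y) * w x - G (∫ y in Set.Iic x, v y) * v x|) ≤
      (∫ y : ℝ, |w y - v y|) * (L₂ * (∫ y : ℝ, |v y|) + B) := by
  set D := ∫ y : ℝ, |w y - v y|
  have hd : Integrable fun y ↦ |w y - v y| := (hw.sub hv).abs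
  have hprim (x : ℝ) : |(∫ y in Set.Iic x, w y) - ∫ y in Set.Iic x, v y| ≤ D := by
    rw [← integral_sub hw.integrableOn hv.integrableOn]
    exact abs_integral_le_integral_abs.trans
      (setIntegral_le_integral hd (.of_forall fun y ↦ abs_nonneg _))
  have hpt (x : ℝ) :
      |G (∫ y in Set.Iic x, w y) * w x - G (∫ y in Set.Iic x, v y) * v x| ≤
        L₂ * D * |v x| + B * |w x - v x| := by
    set a := ∫ y in Set.Iic x, w y
    set b := ∫ y in Set.Iic x, v y
    calc |G a * w x - G b * v x|
        = |(G a - G b) * v x + G a * (w x - v x)| := by ring_nf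
      _ ≤ |G a - G b| * |v x| + |G a| * |w x - v x| := by
        simpa only [abs_mul] using abs_add_le ((G a - G b) * v x) (G a * (w x - v x))
      _ ≤ L₂ * D * |v x| + B * |w x - v x| := by
        gcongr
        · exact (hG a b).trans (mul_le_mul_of_nonneg_left (hprim x) hL₂)
        · exact hB a
  have hv' : Integrable fun x ↦ L₂ * D * |v x| := hv.abs.const_mul _
  have hd' : Integrable fun x ↦ B * |w x - v x| := hd.const_mul _
  calc _ ≤ ∫ x, (L₂ * D * |v x| + B * |w x - v x|) :=
        integral_mono_of_nonneg (.of_forall fun x ↦ abs_nonneg _) (hv'.add hd')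
          (.of_forall hpt)
    _ = D * (L₂ * (∫ y : ℝ, |v y|) + B) := by
        rw [integral_add hv' hd', integral_const_mul, integral_const_mul]
        ring


open MeasureTheory Set

/-- For `G` bounded and Lipschitz and `w, v` integrable,
`∫ |G(∫_{-∞}^x w) w(x) - G(∫_{-∞}^x v) v(x)| dx
  ≤ ‖w - v‖_{L¹} (L₂ min(‖w‖_{L¹}, ‖v‖_{L¹}) + B)`.
Applied with `G = f''`, this estimates `TV(k - l)` for the nonlocal
coefficients. -/
theorem TV_difference_nonlocal_coefficients (G w v : ℝ → ℝ) (L₂ B : ℝ)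
    (hL₂ : 0 ≤ L₂) (hG : ∀ x y, |G x - G y| ≤ L₂ * |x - y|)
    (hB : ∀ x, |G x| ≤ B)
    (hw : Integrable w) (hv : Integrable v) :
    (∫ x : ℝ, |G (∫ y in Set.Iic x, w y) * w x - G (∫ y in Set.Iic x, v y) * v x|) ≤
      (∫ y : ℝ, |w y - v y|) *
        (L₂ * min (∫ y : ℝ, |w y|) (∫ y : ℝ, |v y|) + B) := by
  rcases min_choice (∫ y : ℝ, |w y|) (∫ y : ℝ, |v y|) with h | h <;> rw [h]
  · simpa only [abs_sub_comm] using integral_abs_nonlocal_sub_le G v w L₂ B hL₂ hG hB hv hw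
  · exact integral_abs_nonlocal_sub_le G w v L₂ B hL₂ hG hB hw hv
end

section
/- Let M > 0, let g : ℝ → ℝ be Lipschitz with Lipschitz constant L and g(s) = 0 for all |s| > M, and let c ≥ 0 satisfy c · L < 1. Let U : ℕ → ℝ be a sequence with U₀ ≤ M and Uₙ₊₁ ≤ Uₙ + c·| g(Uₙ) − g(Uₙ₊₁) | for all n. Then Uₙ ≤ M for all n ∈ ℕ. -/
/-- **Discrete maximum principle** underlying the `L^∞` bound for monotone
finite-difference approximations: if `g` is `L`-Lipschitz and vanishes
outside `[-M, M]`, `c ≥ 0` with `c·L < 1`, `U₀ ≤ M` and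
`Uₙ₊₁ ≤ Uₙ + c·|g(Uₙ) - g(Uₙ₊₁)|` for all `n`, then `Uₙ ≤ M` for all `n`. -/
theorem discrete_maximum_principle (M L c : ℝ) (g : ℝ → ℝ) (U : ℕ → ℝ)
    (hM : 0 < M)
    (hg : ∀ x y, |g x - g y| ≤ L * |x - y|)
    (hsupp : ∀ s : ℝ, M < |s| → g s = 0)
    (hc : 0 ≤ c) (hcL : c * L < 1)
    (hU0 : U 0 ≤ M)
    (hrec : ∀ n : ℕ, U (n + 1) ≤ U n + c * |g (U n) - g (U (n + 1))|) :
    ∀ n : ℕ, U n ≤ M := by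
  intro n
  induction n with
  | zero => exact hU0
  | succ n ih =>
    by_contra! h
    have hlip := mul_le_mul_of_nonneg_left (hg (U n) (U (n + 1))) hc
    rw [abs_sub_comm (U n), abs_of_pos (by linarith : 0 < U (n + 1) - U n)] at hlip
    have hlt := mul_lt_mul_of_pos_right hcL (by linarith : 0 < U (n + 1) - U n)
    linarith [hrec n]
end
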